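/- For all reals α, β with 1 < α < β, there exists an infinite binary (or finite-alphabet) sequence ω and ε > 0 such that: (a) for every rational r with 1 < r < α, ω contains a substring that is a fractional power of exponent exactly r; and (b) every substring of ω of length n is at Hamming distance at least ε·n from every fractional power of exponent ≥ β of length n. -/

import Mathlib

/-- `Z` is a fractional power of `X` (i.e. `Z = X…XY` with `Y` a prefix of `X`). -/
def IsFracPower {α : Type*} (Z X : List α) : Prop :=
  X ≠ [] ∧ ∃ (k : ℕ) (Y : List α), Y <+: X ∧ Z = (List.replicate k X).flatten ++ Y

/-- Hamming distance between two lists (of the same length). -/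
def listHamming {α : Type*} [DecidableEq α] (u v : List α) : ℕ :=
  ((u.zip v).filter fun p => p.1 ≠ p.2).length

/-- The parity of the number of pairs of binary digits `1` of `i` at distance `L`. -/
def shapiroParity (L i : ℕ) : ZMod 2 :=
  if i = 0 then 0 else shapiroParity L (i / 2) + (i : ZMod 2) * ((i / 2 ^ L : ℕ) : ZMod 2)
termination_by i
decreasing_by omega

theorem shapiroParity_eq (L i : ℕ) :
    shapiroParity L i =
      shapiroParity L (i / 2) + (i : ZMod 2) * ((i / 2 ^ L : ℕ) : ZMod 2) := by
  by_cases h : i = 0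
  · subst h; simp
  · rw [shapiroParity, if_neg h]

theorem shapiroParity_add_sub (l t i : ℕ) :
    shapiroParity (l + 1) (i + 2 ^ (l + 1) * t) - shapiroParity (l + 1) i =
      (t : ZMod 2) * i +
        (shapiroParity (l + 1) (i / 2 + 2 ^ l * t) - shapiroParity (l + 1) (i / 2)) := by
  rw [shapiroParity_eq (l + 1) (i + 2 ^ (l + 1) * t), shapiroParity_eq (l + 1) i]
  have h1 : (i + 2 ^ (l + 1) * t) / 2 = i / 2 + 2 ^ l * t := by
    rw [pow_succ, mul_comm (2 ^ l) 2, mul_assoc]; omega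
  have h2 : (i + 2 ^ (l + 1) * t) / 2 ^ (l + 1) = i / 2 ^ (l + 1) + t :=
    Nat.add_mul_div_left _ _ (by positivity)
  have h3 : (2 : ZMod 2) = 0 := rfl
  rw [h1, h2]
  push_cast
  rw [pow_succ, h3]
  ring

theorem shapiroParity_add_two_pow_mul_sub (l s t i : ℕ) :
    shapiroParity (l + 1) (i + 2 ^ (l + 1) * (2 ^ s * t)) - shapiroParity (l + 1) i =
      shapiroParity (l + 1) (i / 2 ^ s + 2 ^ (l + 1) * t) -
        shapiroParity (l + 1) (i / 2 ^ s) := by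
  induction s generalizing i with
  | zero => simp
  | succ s ih =>
    have h3 : (2 : ZMod 2) = 0 := rfl
    have h4 : i / 2 + 2 ^ l * (2 ^ (s + 1) * t) = i / 2 + 2 ^ (l + 1) * (2 ^ s * t) := by ring
    rw [shapiroParity_add_sub, h4, ih, Nat.div_div_eq_div_mul, ← pow_succ']
    push_cast
    rw [pow_succ _ s, h3]
    ring

theorem shapiroParity_add_sub_two_mul_add_one (l k : ℕ) {t : ℕ} (ht : Odd t) :
    shapiroParity (l + 1) (2 * k + 1 + 2 ^ (l + 1) * t) - shapiroParity (l + 1) (2 * k + 1) =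
      shapiroParity (l + 1) (2 * k + 2 ^ (l + 1) * t) - shapiroParity (l + 1) (2 * k) + 1 := by
  have h3 : (2 : ZMod 2) = 0 := rfl
  obtain ⟨m, rfl⟩ := ht
  rw [shapiroParity_add_sub, shapiroParity_add_sub]
  have h1 : (2 * k + 1) / 2 = k := by omega
  have h2 : (2 * k) / 2 = k := by omega
  rw [h1, h2]
  push_cast
  rw [h3]
  ring

theorem abs_sum_range_le_one {s : ℕ → ℤ} (hs : ∀ k, s (2 * k + 1) = -s (2 * k))
    (h1 : ∀ k, |s k| ≤ 1) (m : ℕ) : |∑ j ∈ Finset.range m, s j| ≤ 1 := by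
  have h0 : ∀ k, ∑ j ∈ Finset.range (2 * k), s j = 0 := by
    intro k
    induction k with
    | zero => simp
    | succ k ih => rw [mul_add, mul_one, Finset.sum_range_succ, Finset.sum_range_succ, ih, hs]; ring
  obtain ⟨k, rfl | rfl⟩ := Nat.even_or_odd' m
  · simp [h0]
  · rw [Finset.sum_range_succ, h0, zero_add]; exact h1 _

theorem sum_range_mul_add_comp_div (s : ℕ → ℤ) (P m r : ℕ) (hr : r ≤ P) :
    ∑ i ∈ Finset.range (P * m + r), s (i / P) =
      P * ∑ j ∈ Finset.range m, s j + r * s m := by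
  have key : ∀ m r, r ≤ P → ∑ i ∈ Finset.range (P * m + r), s (i / P) =
      ∑ i ∈ Finset.range (P * m), s (i / P) + r * s m := by
    intro m r hr
    rw [Finset.sum_range_add]
    congr 1
    rw [Finset.sum_congr rfl (g := fun _ => s m)]
    · simp
    · intro x hx
      have hx := Finset.mem_range.1 hx
      rw [Nat.mul_add_div (by omega), Nat.div_eq_of_lt (by omega), add_zero]
  rw [key m r hr]
  congr 1
  induction m with
  | zero => simp
  | succ m ih => rw [mul_add, mul_one, key m P le_rfl, ih, Finset.sum_range_succ]; ring

theorem abs_sum_range_comp_div_le {s : ℕ → ℤ} (hs : ∀ k, s (2 * k + 1) = -s (2 * k))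
    (h1 : ∀ k, |s k| ≤ 1) {P : ℕ} (hP : 0 < P) (n : ℕ) :
    |∑ i ∈ Finset.range n, s (i / P)| ≤ P := by
  have hr : n % P < P := Nat.mod_lt _ hP
  have h2 := abs_sum_range_le_one hs h1 (n / P)
  have h3 := abs_sum_range_le_one hs h1 (n / P + 1)
  rw [Finset.sum_range_succ] at h3
  rw [← Nat.div_add_mod n P, sum_range_mul_add_comp_div s P _ _ hr.le]
  set D := ∑ j ∈ Finset.range (n / P), s j
  set r := n % P
  have hr' : (r : ℤ) < P := by exact_mod_cast hr
  have hr0 : (0 : ℤ) ≤ r := by positivity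
  rw [abs_le] at *
  constructor <;> nlinarith

theorem two_mul_card_filter_comp_div_le {w : ℕ → ZMod 2} (hw : ∀ k, w (2 * k + 1) = w (2 * k) + 1)
    {P : ℕ} (hP : 0 < P) {x y : ℕ} (hxy : x ≤ y) :
    2 * ((Finset.Ico x y).filter fun i => w (i / P) = 0).card ≤ (y - x) + 2 * P := by
  let s : ℕ → ℤ := fun j => if w j = 0 then 1 else -1
  have hs : ∀ k, s (2 * k + 1) = -s (2 * k) := by
    intro k
    simp only [s, hw]
    generalize w (2 * k) = z
    revert z; decide
  have h1 : ∀ k, |s k| ≤ 1 := by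
    intro k; simp only [s]; split_ifs <;> simp
  have h2 := abs_le.1 (abs_sum_range_comp_div_le hs h1 hP x)
  have h3 := abs_le.1 (abs_sum_range_comp_div_le hs h1 hP y)
  have h4 := Finset.sum_range_add_sum_Ico (fun i => s (i / P)) hxy
  have h5 : ∑ i ∈ Finset.Ico x y, s (i / P) =
      2 * ((Finset.Ico x y).filter fun i => w (i / P) = 0).card - ((y - x : ℕ) : ℤ) := by
    have : ∀ i, s (i / P) = 2 * (if w (i / P) = 0 then 1 else 0) - 1 := by
      intro i; simp only [s]; split_ifs <;> simp
    simp_rw [this]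
    rw [Finset.sum_sub_distrib, ← Finset.mul_sum, Finset.sum_boole]
    simp
  omega

/-- Letters record the residue of the index modulo `2 ^ L` and the parity `shapiroParity L`. -/
def shapiroLetter (L i : ℕ) : ZMod (2 ^ L) × ZMod 2 := (i, shapiroParity L i)

theorem card_shapiroLetter_eq_le (l : ℕ) {d : ℕ} (hd : 0 < d) {x y : ℕ} (hxy : x ≤ y) :
    (((Finset.Ico x y).filter fun i =>
      shapiroLetter (l + 1) i = shapiroLetter (l + 1) (i + d)).card : ℝ) ≤
      ((y : ℝ) - x) / 2 + d / 2 ^ (l + 1) := by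
  have hxy' : (x : ℝ) ≤ y := by exact_mod_cast hxy
  by_cases h : 2 ^ (l + 1) ∣ d
  · obtain ⟨e, rfl⟩ := h
    obtain ⟨s, t, ht, rfl⟩ := Nat.exists_eq_two_pow_mul_odd (n := e) (by rintro rfl; simp at hd)
    have h1 := two_mul_card_filter_comp_div_le
      (w := fun j => shapiroParity (l + 1) (j + 2 ^ (l + 1) * t) - shapiroParity (l + 1) j)
      (fun k => shapiroParity_add_sub_two_mul_add_one l k ht) (P := 2 ^ s) (by positivity) hxy
    have h2 : ((Finset.Ico x y).filter fun i =>
        shapiroLetter (l + 1) i = shapiroLetter (l + 1) (i + 2 ^ (l + 1) * (2 ^ s * t))).card ≤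
        ((Finset.Ico x y).filter fun i => shapiroParity (l + 1) (i / 2 ^ s + 2 ^ (l + 1) * t) -
          shapiroParity (l + 1) (i / 2 ^ s) = 0).card := by
      apply Finset.card_le_card
      intro i
      simp only [Finset.mem_filter]
      rintro ⟨hi, he⟩
      refine ⟨hi, ?_⟩
      rw [← shapiroParity_add_two_pow_mul_sub, sub_eq_zero]
      exact (congrArg Prod.snd he).symm
    have h3 : ((2 ^ (l + 1) * (2 ^ s * t) : ℕ) : ℝ) / 2 ^ (l + 1) = 2 ^ s * t := by
      push_cast; field_simp
    have h4 : (1 : ℝ) ≤ t := by exact_mod_cast ht.pos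
    have h5 : (2 : ℝ) ^ s ≤ 2 ^ s * t := le_mul_of_one_le_right (by positivity) h4
    have h6 := (Nat.mul_le_mul_left 2 h2).trans h1
    have h7 : (2 : ℝ) * ((Finset.Ico x y).filter fun i =>
        shapiroLetter (l + 1) i = shapiroLetter (l + 1) (i + 2 ^ (l + 1) * (2 ^ s * t))).card ≤
        (y - x) + 2 * 2 ^ s := by
      rw [← Nat.cast_sub hxy]; exact_mod_cast h6
    rw [h3]; linarith
  · rw [Finset.filter_false_of_mem]
    · simp; linarith [show (0 : ℝ) ≤ d / 2 ^ (l + 1) by positivity]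
    · intro i _ he
      have := congrArg Prod.fst he
      simp only [shapiroLetter, Nat.cast_add, left_eq_add] at this
      exact h ((ZMod.natCast_eq_zero_iff _ _).1 this)

theorem map_range_mul_add_of_periodic {A : Type*} {z : ℕ → A} {q : ℕ} (hz : ∀ i, z (q + i) = z i)
    (k r : ℕ) : (List.range (k * q + r)).map z =
      (List.replicate k ((List.range q).map z)).flatten ++ (List.range r).map z := by
  induction k with
  | zero => simp
  | succ k ih =>
    have : (k + 1) * q + r = q + (k * q + r) := by ring
    rw [this, List.range_add, List.map_append, List.map_map, List.replicate_succ,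
      List.flatten_cons, List.append_assoc, ← ih]
    congr 2
    exact funext hz

theorem isFracPower_map_range {A : Type*} {z : ℕ → A} {p q : ℕ} (hq : 0 < q)
    (hz : ∀ j < p, z j = z (j % q)) :
    IsFracPower ((List.range p).map z) ((List.range q).map fun i => z (i % q)) := by
  refine ⟨by simp; omega, p / q, (List.range (p % q)).map fun i => z (i % q), ?_, ?_⟩
  · have h : q = p % q + (q - p % q) := by have := Nat.mod_lt p hq; omega
    conv_rhs => rw [h, List.range_add, List.map_append, ← h]
    exact List.prefix_append _ _
  · rw [← map_range_mul_add_of_periodic (z := fun i => z (i % q)) (by simp),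
      mul_comm, Nat.div_add_mod]
    exact List.map_congr_left fun j hj => hz j (List.mem_range.1 hj)

theorem IsFracPower.getElem?_add_length {A : Type*} {Z X : List A} (h : IsFracPower Z X) {i : ℕ}
    (hi : i + X.length < Z.length) : Z[i + X.length]? = Z[i]? := by
  obtain ⟨-, k, Y, hY, rfl⟩ := h
  set F := (List.replicate k X).flatten
  have hF : F ++ X = X ++ F := by
    have h1 : F ++ X = (List.replicate (k + 1) X).flatten := by
      rw [List.replicate_succ']; simp [F]
    rw [h1, List.replicate_succ, List.flatten_cons]
  have hpre : F ++ Y <+: X ++ (F ++ Y) := by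
    rw [← List.append_assoc, ← hF]
    exact ((List.prefix_append_right_inj F).2 hY).trans (List.prefix_append _ _)
  rw [List.getElem?_eq_getElem hi, hpre.getElem hi, ← List.getElem?_eq_getElem,
    List.getElem?_append_right (Nat.le_add_left _ _), Nat.add_sub_cancel]

theorem listHamming_map_range {A : Type*} [DecidableEq A] (z w : ℕ → A) (n : ℕ) :
    listHamming ((List.range n).map z) ((List.range n).map w) =
      ((Finset.range n).filter fun i => z i ≠ w i).card := by
  rw [listHamming, List.zip_map', List.filter_map, List.length_map]
  rfl

theorem card_ne_shift_le_two_mul_listHamming {A : Type*} [DecidableEq A] {z : ℕ → A}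
    {W X : List A} (h : IsFracPower W X) :
    ((Finset.range (W.length - X.length)).filter fun i => z i ≠ z (i + X.length)).card ≤
      2 * listHamming ((List.range W.length).map z) W := by
  obtain ⟨w, hw⟩ : ∃ w : ℕ → A, ∀ i (hi : i < W.length), W[i] = w i := by
    refine ⟨fun i => W.getD i (X.head h.1), fun i hi => ?_⟩
    simp [hi]
  have hW : W = (List.range W.length).map w := by
    apply List.ext_getElem <;> simp [hw]
  have hper : ∀ i, i + X.length < W.length → w (i + X.length) = w i := by
    intro i hi
    have := h.getElem?_add_length hi
    rw [List.getElem?_eq_getElem hi, List.getElem?_eq_getElem (by omega), hw, hw] at this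
    exact Option.some.inj this
  have hH : listHamming ((List.range W.length).map z) W =
      ((Finset.range W.length).filter fun i => z i ≠ w i).card := by
    conv_lhs => rw [hW]
    simpa using listHamming_map_range z w W.length
  rw [hH]
  set E := (Finset.range W.length).filter fun i => z i ≠ w i
  have hsub : ((Finset.range (W.length - X.length)).filter fun i => z i ≠ z (i + X.length)) ⊆
      E ∪ E.image (· - X.length) := by
    intro i
    simp only [Finset.mem_filter, Finset.mem_union, Finset.mem_image, Finset.mem_range, E]
    rintro ⟨hi, hne⟩
    by_cases h1 : z i = w i
    · refine Or.inr ⟨i + X.length, ⟨by omega, fun h2 => hne ?_⟩, by omega⟩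
      rw [h1, h2, hper i (by omega)]
    · exact Or.inl ⟨by omega, h1⟩
  calc _ ≤ (E ∪ E.image (· - X.length)).card := Finset.card_le_card hsub
    _ ≤ E.card + E.card := (Finset.card_union_le _ _).trans
        (Nat.add_le_add_left Finset.card_image_le _)
    _ = _ := by ring

/-- On every interval, `u` agrees with its shift by `d` at most half of the time, up to an error
`d / H`. -/
def HasFewMatches {B : Type*} [DecidableEq B] (u : ℕ → B) (H : ℝ) : Prop :=
  ∀ d, 0 < d → ∀ x y, x ≤ y →
    (((Finset.Ico x y).filter fun i => u i = u (i + d)).card : ℝ) ≤ ((y : ℝ) - x) / 2 + d / H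

theorem HasFewMatches.card_filter_le {B : Type*} [DecidableEq B] {u : ℕ → B} {H : ℝ}
    (hu : HasFewMatches u H) (hH : 0 < H) {d : ℕ} (hd : 0 < d) {F : Finset ℕ}
    (hF : ∀ x ∈ F, ∀ z ∈ F, ∀ y, x ≤ y → y ≤ z → y ∈ F) {g : ℕ → ℕ} {b : ℕ}
    (hg : ∀ i ∈ F, i = g i + b) {p : ℕ → Prop} [DecidablePred p]
    (hp : ∀ i ∈ F, p i → u (g i) = u (g i + d)) :
    ((F.filter p).card : ℝ) ≤ F.card / 2 + d / H := by
  rcases F.eq_empty_or_nonempty with rfl | hne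
  · simp; positivity
  · have hx := F.min'_mem hne
    have hy := F.max'_mem hne
    set x := F.min' hne
    set y := F.max' hne
    have hxy : x ≤ y := F.min'_le _ hy
    have hF' : F = Finset.Ico x (y + 1) := by
      ext i
      rw [Finset.mem_Ico]
      exact ⟨fun hi => ⟨F.min'_le _ hi, Nat.lt_succ_of_le (F.le_max' _ hi)⟩,
        fun hi => hF x hx y hy i hi.1 (Nat.le_of_lt_succ hi.2)⟩
    have hbx := hg x hx
    have hcard : (F.filter p).card ≤
        ((Finset.Ico (x - b) (y - b + 1)).filter fun i => u i = u (i + d)).card := by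
      apply Finset.card_le_card_of_injOn g
      · intro i hi
        have hi := Finset.mem_filter.1 hi
        have h1 := hg i hi.1
        have h2 := hi.1
        rw [hF', Finset.mem_Ico] at h2
        simp only [Finset.coe_filter, Set.mem_ofPred_eq, Finset.mem_Ico]
        exact ⟨by omega, hp i hi.1 hi.2⟩
      · intro i hi j hj hij
        rw [hg i (Finset.mem_filter.1 hi).1, hg j (Finset.mem_filter.1 hj).1, hij]
    have hFc : F.card = y - b + 1 - (x - b) := by
      rw [hF', Nat.card_Ico]; omega
    have h3 := hu d hd (x - b) (y - b + 1) (by omega)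
    rw [hFc, Nat.cast_sub (by omega)]
    exact (Nat.cast_le.2 hcard).trans h3

/-- The sequence `u` in which the `q`-periodic repetition of `u 0, …, u (q - 1)` is written on the
interval `[P, P + L)`. The first component distinguishes the outside of this interval, and the two
halves of the period. -/
def withPiece {B : Type*} (u : ℕ → B) (P L q i : ℕ) : Fin 3 × B :=
  if P ≤ i ∧ i < P + L then (if 2 * ((i - P) % q) < q then 0 else 1, u ((i - P) % q)) else (2, u i)

/-- Labels the part before the interval `[P, P + L)`, the periods inside, and the part after. -/
def pieceLabel (P L q C i : ℕ) : ℕ :=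
  if i < P then 0 else if i < P + L then 1 + (i - P) / q else C + 1

section Piece

variable {P L q C : ℕ}

theorem pieceLabel_eq_zero {i : ℕ} : pieceLabel P L q C i = 0 ↔ i < P := by
  unfold pieceLabel; split_ifs <;> simp_all

theorem pieceLabel_of_mem {i : ℕ} (h : P ≤ i ∧ i < P + L) :
    pieceLabel P L q C i = 1 + (i - P) / q := by
  rw [pieceLabel, if_neg (by omega), if_pos h.2]

theorem div_lt_of_mem_piece (hC : L ≤ C * q) {i : ℕ} (h : P ≤ i ∧ i < P + L) :
    (i - P) / q < C :=
  Nat.div_lt_of_lt_mul (by rw [mul_comm]; omega)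

theorem mem_piece_iff (hC : L ≤ C * q) {i : ℕ} :
    (P ≤ i ∧ i < P + L) ↔ 1 ≤ pieceLabel P L q C i ∧ pieceLabel P L q C i ≤ C := by
  constructor
  · intro h
    have := div_lt_of_mem_piece hC h
    rw [pieceLabel_of_mem h]
    exact ⟨Nat.le_add_right _ _, by rwa [add_comm]⟩
  · unfold pieceLabel; split_ifs <;> omega

theorem pieceLabel_lt (hC : L ≤ C * q) (i : ℕ) : pieceLabel P L q C i < C + 2 := by
  by_cases h : P ≤ i ∧ i < P + L
  · have := ((mem_piece_iff hC).1 h).2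
    omega
  · unfold pieceLabel; split_ifs <;> omega

theorem pieceLabel_mono (hC : L ≤ C * q) : Monotone (pieceLabel P L q C) := by
  intro i j hij
  by_cases hi : P ≤ i ∧ i < P + L
  · by_cases hj : P ≤ j ∧ j < P + L
    · rw [pieceLabel_of_mem hi, pieceLabel_of_mem hj]
      exact Nat.add_le_add_left (Nat.div_le_div_right (by omega)) _
    · have h1 := ((mem_piece_iff hC).1 hi).2
      have h2 : pieceLabel P L q C j = C + 1 := by
        rw [pieceLabel, if_neg (by omega), if_neg (by omega)]
      omega
  · by_cases h : i < P
    · rw [pieceLabel_eq_zero.2 h]; exact Nat.zero_le _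
    · rw [pieceLabel, pieceLabel, if_neg h, if_neg (by omega), if_neg (by omega), if_neg (by omega)]

variable {B : Type*} {u : ℕ → B}

theorem withPiece_of_mem {i : ℕ} (h : P ≤ i ∧ i < P + L) :
    withPiece u P L q i = (if 2 * ((i - P) % q) < q then 0 else 1, u ((i - P) % q)) :=
  if_pos h

theorem withPiece_of_notMem {i : ℕ} (h : ¬ (P ≤ i ∧ i < P + L)) :
    withPiece u P L q i = (2, u i) :=
  if_neg h

theorem withPiece_ne {i j : ℕ} (hi : P ≤ i ∧ i < P + L) (hj : ¬ (P ≤ j ∧ j < P + L)) :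
    withPiece u P L q i ≠ withPiece u P L q j := by
  rw [withPiece_of_mem hi, withPiece_of_notMem hj]
  intro h
  have := congrArg Prod.fst h
  simp only at this
  split_ifs at this <;> simp_all

variable [DecidableEq B] {H : ℝ} {d : ℕ}

theorem card_withPiece_eq_le_of_period_eq (hu : HasFewMatches u H) (hH : 0 < H) (hd : 0 < d)
    {F : Finset ℕ} (hF : ∀ x ∈ F, ∀ z ∈ F, ∀ y, x ≤ y → y ≤ z → y ∈ F)
    (hin : ∀ i ∈ F, P ≤ i ∧ i + d < P + L) (hdq : d < q) {c c' : ℕ}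
    (hc : ∀ i ∈ F, (i - P) / q = c) (hc' : ∀ i ∈ F, (i + d - P) / q = c') :
    ((F.filter fun i => withPiece u P L q i = withPiece u P L q (i + d)).card : ℝ) ≤
      F.card / 2 + d / H := by
  rcases F.eq_empty_or_nonempty with rfl | ⟨i₀, hi₀⟩
  · simp; positivity
  have hdiv : ∀ i ∈ F, i = (i - P) % q + (P + q * c) ∧ i + d = (i + d - P) % q + (P + q * c') := by
    intro i hi
    have h1 := Nat.mod_add_div (i - P) q
    have h2 := Nat.mod_add_div (i + d - P) q
    rw [hc i hi] at h1
    rw [hc' i hi] at h2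
    have := hin i hi
    omega
  have hmod : ∀ i : ℕ, i % q < q := fun i => Nat.mod_lt _ (by omega)
  have hfst : ∀ i ∈ F, withPiece u P L q i = withPiece u P L q (i + d) →
      (2 * ((i - P) % q) < q ↔ 2 * ((i + d - P) % q) < q) ∧
        u ((i - P) % q) = u ((i + d - P) % q) := by
    intro i hi h
    have := hin i hi
    rw [withPiece_of_mem (by omega), withPiece_of_mem (by omega)] at h
    refine ⟨?_, congrArg Prod.snd h⟩
    have h3 := congrArg Prod.fst h
    by_cases h4 : 2 * ((i - P) % q) < q <;> by_cases h5 : 2 * ((i + d - P) % q) < q <;>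
      simp [h4, h5] at h3 ⊢
  have hcc : c' = c ∨ c' = c + 1 := by
    have h0 := hdiv i₀ hi₀
    have h1 := hmod (i₀ - P)
    have h2 := hmod (i₀ + d - P)
    have h3 : c ≤ c' := by
      rw [← hc i₀ hi₀, ← hc' i₀ hi₀]; exact Nat.div_le_div_right (by omega)
    have h4 : c' < c + 2 := by
      by_contra! h4
      have := Nat.mul_le_mul_left q h4
      rw [mul_add] at this
      omega
    omega
  rcases hcc with rfl | rfl
  · apply hu.card_filter_le hH hd hF (g := fun i => (i - P) % q) (fun i hi => (hdiv i hi).1)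
    intro i hi h
    rw [(hfst i hi h).2]
    congr 1
    have := hdiv i hi
    omega
  · have hdiv' : ∀ i ∈ F, (i + d - P) % q + q = (i - P) % q + d := by
      intro i hi
      have := hdiv i hi
      rw [mul_add] at this
      omega
    by_cases h2 : 2 * d < q
    · rw [Finset.filter_false_of_mem]
      · simp; positivity
      · intro i hi h
        have h3 := (hfst i hi h).1
        have h4 := hdiv' i hi
        have := hmod (i - P)
        omega
    · have h1 := hu.card_filter_le hH (d := q - d) (by omega) hF
        (g := fun i => (i + d - P) % q) (b := P + q * (c + 1) - d)
        (p := fun i => withPiece u P L q i = withPiece u P L q (i + d))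
        (fun i hi => by
          have h3 := hdiv i hi
          have h4 := hdiv' i hi
          rw [mul_add] at h3 ⊢
          omega)
        (fun i hi h => by
          rw [← (hfst i hi h).2]
          congr 1
          have := hdiv' i hi
          omega)
      refine h1.trans ?_
      have : ((q - d : ℕ) : ℝ) ≤ d := by exact_mod_cast (by omega : q - d ≤ d)
      gcongr

theorem card_withPiece_eq_le_of_label_eq (hu : HasFewMatches u H) (hH : 0 < H) (hd : 0 < d)
    (hC : L ≤ C * q) {F : Finset ℕ} (hF : ∀ x ∈ F, ∀ z ∈ F, ∀ y, x ≤ y → y ≤ z → y ∈ F) {k k' : ℕ}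
    (hk : ∀ i ∈ F, pieceLabel P L q C i = k) (hk' : ∀ i ∈ F, pieceLabel P L q C (i + d) = k') :
    ((F.filter fun i => withPiece u P L q i = withPiece u P L q (i + d)).card : ℝ) ≤
      (F.card + (F.filter fun i => q ≤ d ∧ P ≤ i ∧ i + d < P + L).card) / 2 + d / H := by
  have hi : ∀ i ∈ F, (P ≤ i ∧ i < P + L) ↔ (1 ≤ k ∧ k ≤ C) := fun i hi => by
    rw [mem_piece_iff hC, hk i hi]
  have hi' : ∀ i ∈ F, (P ≤ i + d ∧ i + d < P + L) ↔ (1 ≤ k' ∧ k' ≤ C) := fun i hi => by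
    rw [mem_piece_iff hC, hk' i hi]
  by_cases h1 : 1 ≤ k ∧ k ≤ C <;> by_cases h2 : 1 ≤ k' ∧ k' ≤ C
  · have hin : ∀ i ∈ F, P ≤ i ∧ i + d < P + L := fun i h =>
      ⟨((hi i h).2 h1).1, ((hi' i h).2 h2).2⟩
    by_cases hdq : d < q
    · refine (card_withPiece_eq_le_of_period_eq hu hH hd hF hin hdq (c := k - 1) (c' := k' - 1)
        ?_ ?_).trans ?_
      · intro i h
        have := hk i h
        rw [pieceLabel_of_mem ((hi i h).2 h1)] at this
        omega
      · intro i h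
        have := hk' i h
        rw [pieceLabel_of_mem ((hi' i h).2 h2)] at this
        omega
      · gcongr
        simp
    · rw [Finset.filter_true_of_mem (p := fun i => q ≤ d ∧ P ≤ i ∧ i + d < P + L)
        fun i h => ⟨by omega, hin i h⟩]
      have h3 : ((F.filter fun i => withPiece u P L q i = withPiece u P L q (i + d)).card : ℝ) ≤
        F.card := by exact_mod_cast Finset.card_filter_le _ _
      have : 0 ≤ d / H := by positivity
      linarith
  · rw [Finset.filter_false_of_mem]
    · simp; positivity
    · exact fun i h => withPiece_ne ((hi i h).2 h1) (mt (hi' i h).1 h2)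
  · rw [Finset.filter_false_of_mem]
    · simp; positivity
    · exact fun i h => (withPiece_ne ((hi' i h).2 h2) (mt (hi i h).1 h1)).symm
  · refine (hu.card_filter_le hH hd hF (g := id) (b := 0) (fun _ _ => rfl) ?_).trans ?_
    · intro i h he
      rw [withPiece_of_notMem (mt (hi i h).1 h1), withPiece_of_notMem (mt (hi' i h).1 h2)] at he
      exact congrArg Prod.snd he
    · gcongr
      simp

theorem card_withPiece_eq_le (hu : HasFewMatches u H) (hH : 0 < H) (hd : 0 < d)
    (hC : L ≤ C * q) (a b : ℕ) :
    (((Finset.Ico a b).filter fun i =>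
      withPiece u P L q i = withPiece u P L q (i + d)).card : ℝ) ≤
      ((Finset.Ico a b).card +
        ((Finset.Ico a b).filter fun i => q ≤ d ∧ P ≤ i ∧ i + d < P + L).card) / 2 +
        (C + 2) ^ 2 * (d / H) := by
  set f : ℕ → ℕ × ℕ := fun i => (pieceLabel P L q C i, pieceLabel P L q C (i + d))
  set T := Finset.range (C + 2) ×ˢ Finset.range (C + 2)
  have hf : ∀ i, f i ∈ T := fun i => by
    simp only [T, f, Finset.mem_product, Finset.mem_range]
    exact ⟨pieceLabel_lt hC _, pieceLabel_lt hC _⟩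
  have hsum : ∀ S : Finset ℕ, (S.card : ℝ) = ∑ t ∈ T, ((S.filter fun i => f i = t).card : ℝ) :=
    fun S => by exact_mod_cast Finset.card_eq_sum_card_fiberwise fun i _ => hf i
  have hT : ((C : ℝ) + 2) ^ 2 * (d / H) = ∑ t ∈ T, (d / H : ℝ) := by
    simp [T, sq]
  rw [hsum (Finset.filter _ _), hsum (Finset.Ico a b), hsum (Finset.filter _ _), hT,
    ← Finset.sum_add_distrib, Finset.sum_div, ← Finset.sum_add_distrib]
  refine Finset.sum_le_sum fun t _ => ?_
  rw [Finset.filter_comm, Finset.filter_comm _ (fun i => f i = t)]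
  have hm := pieceLabel_mono (P := P) hC
  apply card_withPiece_eq_le_of_label_eq hu hH hd hC (k := t.1) (k' := t.2)
  · intro x hx z hz y hxy hyz
    simp only [Finset.mem_filter, Finset.mem_Ico, f, Prod.ext_iff] at *
    have h1 := hm hxy
    have h2 := hm hyz
    have h3 := hm (Nat.add_le_add_right hxy d)
    have h4 := hm (Nat.add_le_add_right hyz d)
    omega
  · exact fun i hi => congrArg Prod.fst (Finset.mem_filter.1 hi).2
  · exact fun i hi => congrArg Prod.snd (Finset.mem_filter.1 hi).2

end Piece

/-- The sequence `u` in which, for each `q`, a `q`-periodic piece of length `⌊α * q⌋` is written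
at position `R ^ q`. -/
noncomputable def withAllPieces {B : Type*} (u : ℕ → B) (α : ℝ) (R i : ℕ) : Fin 3 × B :=
  withPiece u (R ^ Nat.log R i) ⌊α * Nat.log R i⌋₊ (Nat.log R i) i

section AllPieces

variable {α : ℝ} {R : ℕ}

theorem mul_mul_le_mul_pow (hα : 0 ≤ α) (hR : 2 ≤ R) (q : ℕ) : R * (α * q) ≤ α * R ^ q := by
  have h : R * q ≤ R ^ q := by
    cases q with
    | zero => simp
    | succ q =>
      rw [pow_succ']
      exact Nat.mul_le_mul_left _ (Nat.lt_pow_self (by omega))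
  have h' : (R : ℝ) * q ≤ R ^ q := by exact_mod_cast h
  calc R * (α * q) = α * (R * q) := by ring
    _ ≤ _ := by gcongr

theorem floor_mul_le_pow (hα : 0 ≤ α) (hR : 2 ≤ R) (hαR : α ≤ R) (q : ℕ) : ⌊α * q⌋₊ ≤ R ^ q := by
  have h := mul_mul_le_mul_pow hα hR q
  have hR' : (0 : ℝ) < R := by exact_mod_cast (by omega : 0 < R)
  have h1 : α * q ≤ (R ^ q : ℕ) := by
    push_cast
    refine le_of_mul_le_mul_left (h.trans ?_) hR'
    gcongr
  exact (Nat.floor_le_floor h1).trans (Nat.floor_natCast _).le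

variable {B : Type*} {u : ℕ → B}

theorem withAllPieces_pow_add (hα : 0 ≤ α) (hR : 2 ≤ R) (hαR : α ≤ R) {q j : ℕ}
    (hj : j < ⌊α * q⌋₊) :
    withAllPieces u α R (R ^ q + j) = withAllPieces u α R (R ^ q + j % q) := by
  have hL := floor_mul_le_pow hα hR hαR q
  have hlog : ∀ k < ⌊α * q⌋₊, Nat.log R (R ^ q + k) = q := by
    intro k hk
    apply Nat.log_eq_of_pow_le_of_lt_pow (Nat.le_add_right _ _)
    have := Nat.mul_le_mul_left (R ^ q) hR
    rw [pow_succ]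
    omega
  have hj' : j % q < ⌊α * q⌋₊ := (Nat.mod_le _ _).trans_lt hj
  rw [withAllPieces, withAllPieces, hlog j hj, hlog _ hj', withPiece_of_mem (by omega),
    withPiece_of_mem (by omega)]
  simp

theorem withAllPieces_eq_withPiece (hα : 0 ≤ α) (hR : 2 ≤ R) {q i : ℕ} (hq : Nat.log R i ≤ q)
    (h : q = 0 ∨ R ^ (q - 1) + ⌊α * (q - 1 : ℕ)⌋₊ ≤ i) :
    withAllPieces u α R i = withPiece u (R ^ q) ⌊α * q⌋₊ q i := by
  rcases hq.eq_or_lt with rfl | hlt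
  · rfl
  · have h1 : i < R ^ q := Nat.lt_pow_of_log_lt (by omega) hlt
    have h2 : R ^ Nat.log R i ≤ R ^ (q - 1) := Nat.pow_le_pow_right (by omega) (by omega)
    have h3 : ⌊α * Nat.log R i⌋₊ ≤ ⌊α * (q - 1 : ℕ)⌋₊ := by
      apply Nat.floor_le_floor
      gcongr
      omega
    rw [withAllPieces, withPiece_of_notMem (by omega), withPiece_of_notMem (by omega)]

theorem withAllPieces_of_notMem (hα : 0 ≤ α) (hR : 2 ≤ R) {q i : ℕ} (hq : Nat.log R i ≤ q)
    (h1 : R ^ (q - 1) + ⌊α * (q - 1 : ℕ)⌋₊ ≤ i)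
    (h2 : ¬ (R ^ q ≤ i ∧ i < R ^ q + ⌊α * q⌋₊)) :
    withAllPieces u α R i = (2, u i) := by
  rw [withAllPieces_eq_withPiece hα hR hq (Or.inr h1), withPiece_of_notMem h2]

variable [DecidableEq B] {H : ℝ} {β : ℝ}

theorem card_withAllPieces_ne_ge_of_near (hu : HasFewMatches u H) (hH : 0 < H) (hα : 1 ≤ α)
    (hβ : 0 < β) (hR : 2 ≤ R) {C : ℕ} (hC : α ≤ C) {a n d q : ℕ} (hd : 0 < d) (hdn : β * d ≤ n)
    (hle : d ≤ n) (hlog : ∀ i < a + n, Nat.log R i ≤ q)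
    (ha : q = 0 ∨ R ^ (q - 1) + ⌊α * (q - 1 : ℕ)⌋₊ ≤ a) :
    ((1 - α / β) / 2 - (C + 2) ^ 2 / H) * n ≤
      ((Finset.Ico a (a + (n - d))).filter fun i =>
        withAllPieces u α R i ≠ withAllPieces u α R (i + d)).card := by
  set I := Finset.Ico a (a + (n - d))
  set ω := withAllPieces u α R
  set P := R ^ q
  set L := ⌊α * q⌋₊
  have hα0 : 0 ≤ α := by linarith
  have hL : (L : ℝ) ≤ α * q := Nat.floor_le (by positivity)
  have hCq : L ≤ C * q := by
    have : (L : ℝ) ≤ (C * q : ℕ) := by push_cast; exact hL.trans (by gcongr)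
    exact_mod_cast this
  have hω : ∀ i, a ≤ i → i < a + n → ω i = withPiece u P L q i := fun i h1 h2 =>
    withAllPieces_eq_withPiece hα0 hR (hlog i h2) (ha.imp_right fun h => h.trans h1)
  have hmatch : (I.filter fun i => ω i = ω (i + d)) =
      I.filter fun i => withPiece u P L q i = withPiece u P L q (i + d) := by
    apply Finset.filter_congr
    intro i hi
    have := Finset.mem_Ico.1 hi
    rw [hω i (by omega) (by omega), hω (i + d) (by omega) (by omega)]
  have h1 := card_withPiece_eq_le (P := P) hu hH hd hCq a (a + (n - d))
  rw [← hmatch] at h1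
  have hI : (I.card : ℝ) = n - d := by
    simp [I, Nat.cast_sub hle]
  set D := I.filter fun i => q ≤ d ∧ P ≤ i ∧ i + d < P + L
  have hD : (D.card : ℝ) ≤ (α - 1) * d := by
    rcases D.eq_empty_or_nonempty with h | ⟨i₀, hi₀⟩
    · rw [h]; simp only [Finset.card_empty, Nat.cast_zero]
      exact mul_nonneg (by linarith) (by positivity)
    · have h0 := (Finset.mem_filter.1 hi₀).2
      have hsub : D ⊆ Finset.Ico P (P + (L - d)) := by
        intro i hi
        have := (Finset.mem_filter.1 hi).2
        rw [Finset.mem_Ico]; omega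
      have h2 := Finset.card_le_card hsub
      rw [Nat.card_Ico, Nat.add_sub_cancel_left] at h2
      have h3 : (D.card : ℝ) + d ≤ L := by exact_mod_cast (by omega : D.card + d ≤ L)
      have h4 : (q : ℝ) ≤ d := by exact_mod_cast h0.1
      have h5 : α * q ≤ α * d := by gcongr
      linarith
  have hsum : ((I.filter fun i => ω i = ω (i + d)).card : ℝ) +
      (I.filter fun i => ω i ≠ ω (i + d)).card = I.card := by
    exact_mod_cast Finset.card_filter_add_card_filter_not _
  have h6 : α * d ≤ α / β * n := by
    rw [div_mul_eq_mul_div, le_div_iff₀ hβ]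
    nlinarith
  have h7 : ((C : ℝ) + 2) ^ 2 * (d / H) ≤ (C + 2) ^ 2 / H * n := by
    rw [div_mul_eq_mul_div, mul_div_assoc]
    gcongr
  linarith

theorem card_withAllPieces_ne_ge_of_far (hu : HasFewMatches u H) (hH : 0 < H) (hα : 1 ≤ α)
    (hβ : 0 < β) {K : ℝ} (hR : 2 ≤ R) (hK : 0 < K) (hαR : 2 * (1 + α) ≤ R)
    (hKR : 2 * K * (1 + 2 * α) ≤ R) {a n d q : ℕ}
    (hd : 0 < d) (hdn : β * d ≤ n) (hle : d ≤ n) (hlog : ∀ i < a + n, Nat.log R i ≤ q)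
    (hq : 0 < q) (hqn : R ^ q < a + n)
    (ha : a < R ^ (q - 1) + ⌊α * (q - 1 : ℕ)⌋₊) :
    ((1 - α / β) / 2 - 1 / H - 2 / K) * n ≤
      ((Finset.Ico a (a + (n - d))).filter fun i =>
        withAllPieces u α R i ≠ withAllPieces u α R (i + d)).card := by
  set I := Finset.Ico a (a + (n - d))
  set ω := withAllPieces u α R
  set P := R ^ q
  set L := ⌊α * q⌋₊
  set Q := R ^ (q - 1)
  set M := ⌊α * (q - 1 : ℕ)⌋₊
  have hα0 : 0 ≤ α := by linarith
  set bad := Finset.range (Q + M) ∪ Finset.Ico P (P + L)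
  have hω : ∀ i < a + n, i ∉ bad → ω i = (2, u i) := by
    intro i hi hb
    simp only [bad, Finset.mem_union, Finset.mem_range, Finset.mem_Ico, not_or, not_lt] at hb
    exact withAllPieces_of_notMem hα0 hR (hlog i hi) hb.1 hb.2
  have hsub : (I.filter fun i => ω i = ω (i + d)) ⊆
      (I.filter fun i => u i = u (i + d)) ∪ (bad ∪ bad.image (· - d)) := by
    intro i hi
    rw [Finset.mem_filter] at hi
    have hI := Finset.mem_Ico.1 hi.1
    by_cases h1 : i ∈ bad
    · simp [h1]
    by_cases h2 : i + d ∈ bad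
    · have : i ∈ bad.image (· - d) := Finset.mem_image.2 ⟨i + d, h2, by omega⟩
      simp [this]
    have h3 := hi.2
    rw [hω i (by omega) h1, hω (i + d) (by omega) h2] at h3
    exact Finset.mem_union_left _ (Finset.mem_filter.2 ⟨hi.1, congrArg Prod.snd h3⟩)
  have hcard := (Finset.card_le_card hsub).trans ((Finset.card_union_le _ _).trans
    (Nat.add_le_add_left ((Finset.card_union_le _ _).trans
      (Nat.add_le_add_left Finset.card_image_le _)) _))
  have hcard' : ((I.filter fun i => ω i = ω (i + d)).card : ℝ) ≤
      (I.filter fun i => u i = u (i + d)).card + (bad.card + bad.card) := by exact_mod_cast hcard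
  have hum := hu d hd a (a + (n - d)) (by omega)
  have hI : (I.card : ℝ) = n - d := by
    simp [I, Nat.cast_sub hle]
  push_cast [Nat.cast_sub hle] at hum
  have hbad : (bad.card : ℝ) ≤ Q + M + L := by
    have := Finset.card_union_le (Finset.range (Q + M)) (Finset.Ico P (P + L))
    rw [Finset.card_range, Nat.card_Ico, Nat.add_sub_cancel_left] at this
    exact_mod_cast this
  have hPL := mul_mul_le_mul_pow hα0 hR q
  have hL : (L : ℝ) ≤ α * q := Nat.floor_le (by positivity)
  have hM : (M : ℝ) ≤ α * q := (Nat.floor_le (by positivity)).trans (by gcongr; omega)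
  have hPQ : (P : ℝ) = R * Q := by
    have : P = R * Q := by
      simp only [P, Q]; rw [← pow_succ', Nat.sub_add_cancel hq]
    exact_mod_cast this
  have hP : (R : ℝ) ^ q = P := by simp [P]
  have hR0 : (0 : ℝ) < R := by exact_mod_cast (by omega : 0 < R)
  rw [hP, hPQ] at hPL
  have hαq : α * q ≤ α * Q := by
    refine le_of_mul_le_mul_left (hPL.trans (le_of_eq ?_)) hR0
    ring
  have hn : (P : ℝ) - Q - M ≤ n := by
    have h1 : (P : ℝ) ≤ a + n := by exact_mod_cast hqn.le
    have h2 : (a : ℝ) ≤ Q + M := by exact_mod_cast ha.le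
    linarith
  have hbadn : K * bad.card ≤ n := by
    have h1 : (bad.card : ℝ) ≤ (1 + 2 * α) * Q := by linarith
    have hQ0 : (0 : ℝ) ≤ Q := by positivity
    have h2 : K * bad.card ≤ K * ((1 + 2 * α) * Q) := by gcongr
    have h3 : 2 * K * (1 + 2 * α) * Q ≤ R * Q := by gcongr
    have h4 : 2 * (1 + α) * Q ≤ R * Q := by gcongr
    linarith
  have hsum : ((I.filter fun i => ω i = ω (i + d)).card : ℝ) +
      (I.filter fun i => ω i ≠ ω (i + d)).card = I.card := by
    exact_mod_cast Finset.card_filter_add_card_filter_not _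
  have h6 : (d : ℝ) ≤ α / β * n := by
    rw [div_mul_eq_mul_div, le_div_iff₀ hβ]
    nlinarith [Nat.cast_nonneg (α := ℝ) n]
  have h7 : (d : ℝ) / H ≤ 1 / H * n := by
    rw [div_mul_eq_mul_div, one_mul]
    gcongr
  have h8 : (bad.card : ℝ) ≤ 1 / K * n := by
    rw [div_mul_eq_mul_div, one_mul, le_div_iff₀ hK]
    linarith
  have h9 : (2 : ℝ) / K * n = 2 * (1 / K * n) := by ring
  linarith

end AllPieces

theorem exists_seq_periodic_pieces_and_many_mismatches (α β : ℝ) (hα : 1 < α) (hβ : α < β) :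
    ∃ (m : ℕ) (ω : ℕ → Fin (m + 1)) (c : ℝ), 0 < c ∧
      (∀ q : ℕ, ∃ a, ∀ j : ℕ, (j : ℝ) + 1 ≤ α * q → ω (a + j) = ω (a + j % q)) ∧
      ∀ a n d : ℕ, 0 < d → β * d ≤ n →
        c * n ≤ ((Finset.range (n - d)).filter fun i => ω (a + i) ≠ ω (a + (i + d))).card := by
  have hβ0 : 0 < β := by linarith
  set γ := 1 - α / β
  have hγ : 0 < γ := by simp only [γ, sub_pos, div_lt_one hβ0, hβ]
  obtain ⟨C, hC⟩ := exists_nat_ge α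
  obtain ⟨l, hl⟩ := pow_unbounded_of_one_lt (8 * ((C : ℝ) + 2) ^ 2 / γ) one_lt_two
  obtain ⟨R, hR⟩ := exists_nat_ge (max (2 * (1 + α)) (2 * (16 / γ) * (1 + 2 * α)))
  have hR1 := (le_max_left _ _).trans hR
  have hR2 := (le_max_right _ _).trans hR
  have hRtwo : 2 ≤ R := by
    have : (2 : ℝ) ≤ R := by linarith
    exact_mod_cast this
  set H : ℝ := 2 ^ (l + 1)
  have hH : 0 < H := by positivity
  have hHl : 8 * ((C : ℝ) + 2) ^ 2 / γ ≤ H :=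
    hl.le.trans (pow_le_pow_right₀ one_le_two (Nat.le_succ l))
  have hCH : ((C : ℝ) + 2) ^ 2 / H ≤ γ / 8 := by
    rw [div_le_iff₀ hγ] at hHl
    rw [div_le_iff₀ hH]; linarith
  have hHone : 1 / H ≤ γ / 8 := by
    refine le_trans ?_ hCH
    gcongr
    nlinarith [Nat.cast_nonneg (α := ℝ) C]
  have hu : HasFewMatches (shapiroLetter (l + 1)) H := fun d hd x y hxy =>
    card_shapiroLetter_eq_le l hd hxy
  have hα1 : 1 ≤ α := hα.le
  set ω := withAllPieces (shapiroLetter (l + 1)) α R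
  obtain ⟨m, hm⟩ : ∃ m, Fintype.card (Fin 3 × (ZMod (2 ^ (l + 1)) × ZMod 2)) = m + 1 :=
    Nat.exists_eq_succ_of_ne_zero Fintype.card_ne_zero
  let e := Fintype.equivFinOfCardEq hm
  refine ⟨m, fun i => e (ω i), γ / 8, by positivity, ?_, ?_⟩
  · intro q
    refine ⟨R ^ q, fun j hj => congrArg e
      (withAllPieces_pow_add (by linarith) hRtwo (by linarith) ?_)⟩
    exact Nat.le_floor (by push_cast; exact hj)
  · intro a n d hd hdn
    have hle : d ≤ n := by
      have : (d : ℝ) ≤ n := by nlinarith [Nat.cast_nonneg (α := ℝ) d]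
      exact_mod_cast this
    have hcard : ((Finset.range (n - d)).filter fun i =>
        e (ω (a + i)) ≠ e (ω (a + (i + d)))).card =
        ((Finset.Ico a (a + (n - d))).filter fun i => ω i ≠ ω (i + d)).card := by
      rw [Finset.card_filter, Finset.card_filter, Finset.sum_Ico_eq_sum_range,
        Nat.add_sub_cancel_left]
      simp only [ne_eq, EmbeddingLike.apply_eq_iff_eq, add_assoc]
    rw [hcard]
    set q := Nat.log R (a + n - 1)
    have hlog : ∀ i < a + n, Nat.log R i ≤ q := fun i hi => Nat.log_mono_right (by omega)
    by_cases h : q = 0 ∨ R ^ (q - 1) + ⌊α * (q - 1 : ℕ)⌋₊ ≤ a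
    · refine le_trans ?_ (card_withAllPieces_ne_ge_of_near hu hH hα1 hβ0 hRtwo hC hd hdn hle hlog h)
      gcongr
      linarith
    · push Not at h
      have hqn : R ^ q < a + n := by
        have : R ^ q ≤ a + n - 1 := Nat.pow_log_le_self R (by
          intro h0; simp [q, h0] at h)
        omega
      refine le_trans ?_ (card_withAllPieces_ne_ge_of_far hu hH hα1 hβ0 hRtwo
        (K := 16 / γ) (by positivity) hR1 hR2 hd hdn hle hlog (Nat.pos_of_ne_zero h.1) hqn h.2)
      have : 2 / (16 / γ) = γ / 8 := by field_simp; norm_num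
      rw [this]
      gcongr
      linarith

/-- Theorem 4: for `1 < α < β` there is a finite-alphabet sequence containing
exact `r`-powers for every rational `1 < r < α`, but whose length-`n` substrings
are at Hamming distance at least `ε·n` from every fractional power of exponent
`≥ β`. -/
theorem exists_seq_powers_but_no_approximate_powers (α β : ℝ) (hα : 1 < α) (hβ : α < β) :
    ∃ (m : ℕ) (ω : ℕ → Fin (m + 1)) (ε : ℝ), 0 < ε ∧
      (∀ r : ℚ, 1 < r → (r : ℝ) < α →
        ∃ (a : ℕ) (X : List (Fin (m + 1))),
          IsFracPower ((List.range (r.num.toNat)).map (fun i => ω (a + i))) X ∧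
          X.length = r.den ∧
          ((r.num.toNat : ℚ) / r.den = r)) ∧
      (∀ (a n : ℕ) (W X : List (Fin (m + 1))), W.length = n → IsFracPower W X →
        β ≤ (n : ℝ) / X.length →
        ε * n ≤ (listHamming ((List.range n).map (fun i => ω (a + i))) W : ℝ)) := by
  obtain ⟨m, ω, c, hc, hpow, hmis⟩ := exists_seq_periodic_pieces_and_many_mismatches α β hα hβ
  refine ⟨m, ω, c / 2, by positivity, ?_, ?_⟩
  · intro r hr hrα
    have hnum : 0 ≤ r.num := Rat.num_nonneg.2 (by linarith)
    have hcast : ((r.num.toNat : ℕ) : ℚ) = r.num := by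
      exact_mod_cast congrArg (Int.cast : ℤ → ℚ) (Int.toNat_of_nonneg hnum)
    have hrat : (r.num.toNat : ℚ) / r.den = r := by rw [hcast, Rat.num_div_den]
    obtain ⟨a, ha⟩ := hpow r.den
    refine ⟨a, _, isFracPower_map_range (q := r.den) r.den_pos ?_, by simp, hrat⟩
    intro j hj
    apply ha
    have h1 : (j : ℝ) + 1 ≤ r.num.toNat := by exact_mod_cast hj
    have h2 : ((r.num.toNat : ℕ) : ℝ) / r.den = r := by
      have := congrArg (Rat.cast : ℚ → ℝ) hrat
      rwa [Rat.cast_div, Rat.cast_natCast, Rat.cast_natCast] at this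
    have h3 : (0 : ℝ) < r.den := by exact_mod_cast r.den_pos
    rw [div_eq_iff h3.ne'] at h2
    nlinarith
  · rintro a n W X rfl hWX hexp
    have hX : 0 < X.length := List.length_pos_iff.2 hWX.1
    have hX' : (0 : ℝ) < X.length := by exact_mod_cast hX
    have h1 := hmis a W.length X.length hX ((le_div_iff₀ hX').1 hexp)
    have h2 := card_ne_shift_le_two_mul_listHamming (z := fun i => ω (a + i)) hWX
    have h3 : (((Finset.range (W.length - X.length)).filter fun i =>
        ω (a + i) ≠ ω (a + (i + X.length))).card : ℝ) ≤
        2 * listHamming ((List.range W.length).map fun i => ω (a + i)) W := by exact_mod_cast h2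
    linarith
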